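/- The endomorphisms H₁, H₂, H₃ of n_p are skew-symmetric with respect to g_λ (g_λ(HᵢX, Y) = −g_λ(X, HᵢY)), linearly independent, and satisfy the su(2) commutation relations [H₁, H₂] = 2H₃, [H₂, H₃] = 2H₁, [H₃, H₁] = 2H₂; in particular their span is a 3-dimensional Lie subalgebra of the Lie algebra of g_λ-skew-symmetric endomorphisms of n_p. -/

import Mathlib

/-! Common setup: the quaternionic Heisenberg Lie algebra `n_p` of dimension `4p+3`,
realised as `ℝ^{4p+3}` with orthonormal basis `ξ₁ ξ₂ ξ₃ τ₁ … τ_{4p}`. -/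

noncomputable section

open scoped BigOperators

/-- The underlying vector space of the quaternionic Heisenberg Lie algebra `n_p`. -/
abbrev NV (p : ℕ) : Type := Fin (4 * p + 3) → ℝ

/-- The inner product `g_λ` for which the standard basis is orthonormal. -/
def gIP {p : ℕ} (X Y : NV p) : ℝ := ∑ a, X a * Y a

/-- Index of the basis vector `ξ_{i+1}`, `i = 0, 1, 2`. -/
def zI (p : ℕ) (i : Fin 3) : Fin (4 * p + 3) := ⟨i.val, by have := i.isLt; omega⟩

/-- Index of the basis vector `τ_{ip + r + 1}`, `i = 0, 1, 2, 3`, `r = 0, …, p-1`. -/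
def tI (p : ℕ) (i : Fin 4) (r : Fin p) : Fin (4 * p + 3) :=
  ⟨3 + i.val * p + r.val, by
    have h1 := i.isLt; have h2 := r.isLt
    have h3 : i.val * p ≤ 3 * p := Nat.mul_le_mul_right p (by omega)
    omega⟩

/-- The basis vector `ξ_{i+1}`. -/
def xi (p : ℕ) (i : Fin 3) : NV p := Pi.single (zI p i) 1

/-- The basis vector `τ_{ip + r + 1}`. -/
def tau (p : ℕ) (i : Fin 4) (r : Fin p) : NV p := Pi.single (tI p i r) 1

/-- The Lie bracket of `n_p`: the bilinear extension of
`[τ_r, τ_{p+r}] = [τ_{2p+r}, τ_{3p+r}] = λ ξ₁`, `[τ_r, τ_{2p+r}] = [τ_{3p+r}, τ_{p+r}] = λ ξ₂`,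
`[τ_r, τ_{3p+r}] = [τ_{p+r}, τ_{2p+r}] = λ ξ₃`, all other brackets of basis vectors being zero. -/
def bracket (p : ℕ) (lam : ℝ) (X Y : NV p) : NV p :=
  (lam * ∑ r : Fin p,
      (X (tI p 0 r) * Y (tI p 1 r) - X (tI p 1 r) * Y (tI p 0 r)
        + X (tI p 2 r) * Y (tI p 3 r) - X (tI p 3 r) * Y (tI p 2 r))) • xi p 0
  + (lam * ∑ r : Fin p,
      (X (tI p 0 r) * Y (tI p 2 r) - X (tI p 2 r) * Y (tI p 0 r)
        + X (tI p 3 r) * Y (tI p 1 r) - X (tI p 1 r) * Y (tI p 3 r))) • xi p 1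
  + (lam * ∑ r : Fin p,
      (X (tI p 0 r) * Y (tI p 3 r) - X (tI p 3 r) * Y (tI p 0 r)
        + X (tI p 1 r) * Y (tI p 2 r) - X (tI p 2 r) * Y (tI p 1 r))) • xi p 2

/-- `dη_i(X, Y) := -η_i([X, Y])`. -/
def dEta (p : ℕ) (lam : ℝ) (i : Fin 3) (X Y : NV p) : ℝ := -(bracket p lam X Y (zI p i))

/-- The three almost contact endomorphisms `φ₁, φ₂, φ₃` of `n_p`. -/
def phi (p : ℕ) : Fin 3 → NV p → NV p :=
  ![fun X => X (zI p 1) • xi p 2 - X (zI p 2) • xi p 1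
      + ∑ r : Fin p, (X (tI p 0 r) • tau p 1 r - X (tI p 1 r) • tau p 0 r
          + X (tI p 2 r) • tau p 3 r - X (tI p 3 r) • tau p 2 r),
    fun X => X (zI p 2) • xi p 0 - X (zI p 0) • xi p 2
      + ∑ r : Fin p, (X (tI p 0 r) • tau p 2 r - X (tI p 2 r) • tau p 0 r
          + X (tI p 3 r) • tau p 1 r - X (tI p 1 r) • tau p 3 r),
    fun X => X (zI p 0) • xi p 1 - X (zI p 1) • xi p 0
      + ∑ r : Fin p, (X (tI p 0 r) • tau p 3 r - X (tI p 3 r) • tau p 0 r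
          + X (tI p 1 r) • tau p 2 r - X (tI p 2 r) • tau p 1 r)]

/-- `(η_i ∧ η_j)(X, Y)`. -/
def etaWedge (p : ℕ) (i j : Fin 3) (X Y : NV p) : ℝ :=
  X (zI p i) * Y (zI p j) - Y (zI p i) * X (zI p j)

/-- The 2-forms `H₁ = -(1/λ)dη₁ + 2 η₂∧η₃`, `H₂ = -(1/λ)dη₂ - 2 η₁∧η₃`,
`H₃ = -(1/λ)dη₃ + 2 η₁∧η₂`. -/
def Hform (p : ℕ) (lam : ℝ) : Fin 3 → NV p → NV p → ℝ :=
  ![fun X Y => -(1 / lam) * dEta p lam 0 X Y + 2 * etaWedge p 1 2 X Y,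
    fun X Y => -(1 / lam) * dEta p lam 1 X Y - 2 * etaWedge p 0 2 X Y,
    fun X Y => -(1 / lam) * dEta p lam 2 X Y + 2 * etaWedge p 0 1 X Y]

/-- The 2-form `H_i` regarded as an endomorphism of `n_p` via `g_λ(H_i X, Y) = H_i(X, Y)`. -/
def Hend (p : ℕ) (lam : ℝ) (i : Fin 3) (X : NV p) : NV p :=
  fun b => Hform p lam i X (Pi.single b 1)

/-- `(η₁ ∧ η₂ ∧ η₃)(X, Y, Z)`. -/
def det3 (p : ℕ) (X Y Z : NV p) : ℝ :=
  X (zI p 0) * (Y (zI p 1) * Z (zI p 2) - Y (zI p 2) * Z (zI p 1))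
  - Y (zI p 0) * (X (zI p 1) * Z (zI p 2) - X (zI p 2) * Z (zI p 1))
  + Z (zI p 0) * (X (zI p 1) * Y (zI p 2) - X (zI p 2) * Y (zI p 1))

/-- The torsion 3-form `T = η₁∧dη₁ + η₂∧dη₂ + η₃∧dη₃ - 4λ η₁∧η₂∧η₃`. -/
def Tform (p : ℕ) (lam : ℝ) (X Y Z : NV p) : ℝ :=
  (∑ i : Fin 3,
    (X (zI p i) * dEta p lam i Y Z - Y (zI p i) * dEta p lam i X Z
      + Z (zI p i) * dEta p lam i X Y)) - 4 * lam * det3 p X Y Z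

/-- The standard basis vector `e_a` of `n_p`. -/
def basisE (p : ℕ) (a : Fin (4 * p + 3)) : NV p := Pi.single a 1

end

lemma zI_inj {p : ℕ} {i j : Fin 3} : zI p i = zI p j ↔ i = j := by
  simp [zI, Fin.ext_iff]

lemma zI_ne_tI {p : ℕ} (i : Fin 3) (j : Fin 4) (r : Fin p) : zI p i ≠ tI p j r := by
  simp only [zI, tI, ne_eq, Fin.mk.injEq]
  omega

lemma tI_inj {p : ℕ} {i j : Fin 4} {r s : Fin p} :
    tI p i r = tI p j s ↔ i = j ∧ r = s := by
  refine ⟨fun h => ?_, fun h => by rw [h.1, h.2]⟩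
  have h' : i.val * p + r.val = j.val * p + s.val := by
    simp only [tI, Fin.mk.injEq] at h
    omega
  have hp : 0 < p := r.pos
  have hr : r.val = s.val := by
    simpa [Nat.mod_eq_of_lt] using congrArg (· % p) h'
  refine ⟨Fin.ext ?_, Fin.ext hr⟩
  rw [hr] at h'
  exact Nat.eq_of_mul_eq_mul_right hp (Nat.add_right_cancel h')

/-- The index map `Fin 3 ⊕ Fin 4 × Fin p → Fin (4p + 3)` listing the `ξ`s and then the `τ`s. -/
def blockIndex (p : ℕ) : Fin 3 ⊕ Fin 4 × Fin p → Fin (4 * p + 3) :=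
  Sum.elim (zI p) (fun q => tI p q.1 q.2)

lemma blockIndex_bijective (p : ℕ) : Function.Bijective (blockIndex p) := by
  rw [Fintype.bijective_iff_injective_and_card]
  constructor
  · rintro (i | ⟨i, r⟩) (j | ⟨j, s⟩) h
    · exact congrArg _ (zI_inj.1 h)
    · exact absurd h (zI_ne_tI _ _ _)
    · exact absurd h.symm (zI_ne_tI _ _ _)
    · obtain ⟨rfl, rfl⟩ := tI_inj.1 h
      rfl
  · simp
    omega

lemma ext_blocks {p : ℕ} {X Y : NV p} (hz : ∀ i, X (zI p i) = Y (zI p i))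
    (ht : ∀ i r, X (tI p i r) = Y (tI p i r)) : X = Y := by
  funext b
  obtain ⟨(i | ⟨i, r⟩), rfl⟩ := (blockIndex_bijective p).2 b
  exacts [hz i, ht i r]

lemma gIP_eq_blocks {p : ℕ} (X Y : NV p) :
    gIP X Y = ∑ i, X (zI p i) * Y (zI p i) + ∑ r, ∑ i, X (tI p i r) * Y (tI p i r) := by
  rw [gIP, ← (blockIndex_bijective p).sum_comp (fun a => X a * Y a), Fintype.sum_sum_type,
    Fintype.sum_prod_type_right]
  rfl

lemma Hend_zI {p : ℕ} {lam : ℝ} (i j : Fin 3) (X : NV p) :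
    Hend p lam i X (zI p j) =
      (![![0, -2 * X (zI p 2), 2 * X (zI p 1)],
         ![2 * X (zI p 2), 0, -2 * X (zI p 0)],
         ![-2 * X (zI p 1), 2 * X (zI p 0), 0]] : Fin 3 → Fin 3 → ℝ) i j := by
  fin_cases i <;> fin_cases j <;>
    simp [Hend, Hform, dEta, bracket, etaWedge, xi, zI_inj, (zI_ne_tI _ _ _).symm]

lemma Hend_tI {p : ℕ} {lam : ℝ} (hlam : lam ≠ 0) (i : Fin 3) (j : Fin 4) (r : Fin p)
    (X : NV p) :
    Hend p lam i X (tI p j r) =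
      (![![-X (tI p 1 r), X (tI p 0 r), -X (tI p 3 r), X (tI p 2 r)],
         ![-X (tI p 2 r), X (tI p 3 r), X (tI p 0 r), -X (tI p 1 r)],
         ![-X (tI p 3 r), -X (tI p 2 r), X (tI p 1 r), X (tI p 0 r)]] :
        Fin 3 → Fin 4 → ℝ) i j := by
  fin_cases i <;> fin_cases j <;>
    simp [Hend, Hform, dEta, bracket, etaWedge, xi, Pi.single_apply, zI_inj, tI_inj,
      zI_ne_tI, hlam]

lemma gIP_Hend_skew {p : ℕ} {lam : ℝ} (hlam : lam ≠ 0) (i : Fin 3) (X Y : NV p) :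
    gIP (Hend p lam i X) Y = -gIP X (Hend p lam i Y) := by
  simp only [gIP_eq_blocks, Hend_zI, Hend_tI hlam, neg_add, ← Finset.sum_neg_distrib]
  congr 1
  · fin_cases i <;> simp [Fin.sum_univ_succ] <;> ring
  · refine Finset.sum_congr rfl fun r _ => ?_
    fin_cases i <;> simp [Fin.sum_univ_succ] <;> ring

lemma Hend_comm_zero_one {p : ℕ} {lam : ℝ} (hlam : lam ≠ 0) (X : NV p) :
    Hend p lam 0 (Hend p lam 1 X) - Hend p lam 1 (Hend p lam 0 X) =
      (2 : ℝ) • Hend p lam 2 X := by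
  refine ext_blocks (fun i => ?_) fun i r => ?_ <;> fin_cases i <;>
    simp [Hend_zI, Hend_tI hlam] <;> ring

lemma Hend_comm_one_two {p : ℕ} {lam : ℝ} (hlam : lam ≠ 0) (X : NV p) :
    Hend p lam 1 (Hend p lam 2 X) - Hend p lam 2 (Hend p lam 1 X) =
      (2 : ℝ) • Hend p lam 0 X := by
  refine ext_blocks (fun i => ?_) fun i r => ?_ <;> fin_cases i <;>
    simp [Hend_zI, Hend_tI hlam] <;> ring

lemma Hend_comm_two_zero {p : ℕ} {lam : ℝ} (hlam : lam ≠ 0) (X : NV p) :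
    Hend p lam 2 (Hend p lam 0 X) - Hend p lam 0 (Hend p lam 2 X) =
      (2 : ℝ) • Hend p lam 1 X := by
  refine ext_blocks (fun i => ?_) fun i r => ?_ <;> fin_cases i <;>
    simp [Hend_zI, Hend_tI hlam] <;> ring

lemma Hend_add_smul {p : ℕ} {lam : ℝ} (hlam : lam ≠ 0) (i : Fin 3) (a b c : ℝ)
    (X Y Z : NV p) :
    Hend p lam i (a • X + b • Y + c • Z) =
      a • Hend p lam i X + b • Hend p lam i Y + c • Hend p lam i Z := by
  refine ext_blocks (fun j => ?_) fun j r => ?_ <;> fin_cases i <;> fin_cases j <;>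
    simp [Hend_zI, Hend_tI hlam] <;> ring

lemma linearIndependent_Hend (p : ℕ) (lam : ℝ) :
    LinearIndependent ℝ ![Hend p lam 0, Hend p lam 1, Hend p lam 2] := by
  rw [Fintype.linearIndependent_iff]
  intro g hg
  have h (k j : Fin 3) := congrFun (congrFun hg (xi p k)) (zI p j)
  have h0 := h 1 2
  have h1 := h 0 2
  have h2 := h 0 1
  simp [Fin.sum_univ_succ, Hend_zI, xi, zI_inj] at h0 h1 h2
  intro i
  fin_cases i
  exacts [h0, h1, h2]

lemma commutator_mem_span_Hend {p : ℕ} {lam : ℝ} (hlam : lam ≠ 0) {A B : NV p → NV p}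
    (hA : A ∈ Submodule.span ℝ ({Hend p lam 0, Hend p lam 1, Hend p lam 2} : Set (NV p → NV p)))
    (hB : B ∈ Submodule.span ℝ ({Hend p lam 0, Hend p lam 1, Hend p lam 2} : Set (NV p → NV p))) :
    (fun X => A (B X) - B (A X)) ∈
      Submodule.span ℝ ({Hend p lam 0, Hend p lam 1, Hend p lam 2} : Set (NV p → NV p)) := by
  rw [Submodule.mem_span_triple] at hA hB ⊢
  obtain ⟨a, b, c, rfl⟩ := hA
  obtain ⟨x, y, z, rfl⟩ := hB
  refine ⟨2 * (b * z - c * y), 2 * (c * x - a * z), 2 * (a * y - b * x), ?_⟩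
  funext X
  have h01 := Hend_comm_zero_one hlam X
  have h12 := Hend_comm_one_two hlam X
  have h20 := Hend_comm_two_zero hlam X
  simp only [Pi.add_apply, Pi.smul_apply, Hend_add_smul hlam]
  rw [mul_comm 2, mul_comm 2, mul_comm 2, mul_smul, mul_smul, mul_smul, ← h01, ← h12, ← h20]
  module

/-- the endomorphisms `H₁, H₂, H₃` of `n_p` are `g_λ`-skew-symmetric, linearly
independent and satisfy the `su(2)` relations `[H₁,H₂] = 2H₃`, `[H₂,H₃] = 2H₁`,
`[H₃,H₁] = 2H₂`; in particular their span is a 3-dimensional Lie subalgebra of the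
`g_λ`-skew-symmetric endomorphisms of `n_p`. -/
theorem quaternionic_heisenberg_H_su2
    (p : ℕ) (hp : 1 ≤ p) (lam : ℝ) (hlam : 0 < lam) :
    -- skew-symmetry:
    (∀ i : Fin 3, ∀ X Y : NV p, gIP (Hend p lam i X) Y = -gIP X (Hend p lam i Y)) ∧
    -- linear independence:
    LinearIndependent ℝ ![Hend p lam 0, Hend p lam 1, Hend p lam 2] ∧
    -- `su(2)` commutation relations:
    (∀ X : NV p,
      Hend p lam 0 (Hend p lam 1 X) - Hend p lam 1 (Hend p lam 0 X) = (2 : ℝ) • Hend p lam 2 X) ∧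
    (∀ X : NV p,
      Hend p lam 1 (Hend p lam 2 X) - Hend p lam 2 (Hend p lam 1 X) = (2 : ℝ) • Hend p lam 0 X) ∧
    (∀ X : NV p,
      Hend p lam 2 (Hend p lam 0 X) - Hend p lam 0 (Hend p lam 2 X) = (2 : ℝ) • Hend p lam 1 X) ∧
    -- the span is closed under the commutator …
    (∀ A B : NV p → NV p,
      A ∈ Submodule.span ℝ ({Hend p lam 0, Hend p lam 1, Hend p lam 2} : Set (NV p → NV p)) →
      B ∈ Submodule.span ℝ ({Hend p lam 0, Hend p lam 1, Hend p lam 2} : Set (NV p → NV p)) →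
      (fun X => A (B X) - B (A X))
        ∈ Submodule.span ℝ ({Hend p lam 0, Hend p lam 1, Hend p lam 2} : Set (NV p → NV p))) ∧
    -- … and is 3-dimensional:
    Module.finrank ℝ
      (Submodule.span ℝ ({Hend p lam 0, Hend p lam 1, Hend p lam 2} : Set (NV p → NV p))) = 3 := by
  have hl : lam ≠ 0 := hlam.ne'
  refine ⟨gIP_Hend_skew hl, linearIndependent_Hend p lam, Hend_comm_zero_one hl,
    Hend_comm_one_two hl, Hend_comm_two_zero hl,
    fun A B hA hB => commutator_mem_span_Hend hl hA hB, ?_⟩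
  have h : ({Hend p lam 0, Hend p lam 1, Hend p lam 2} : Set (NV p → NV p)) =
      Set.range ![Hend p lam 0, Hend p lam 1, Hend p lam 2] := by
    ext A
    simp only [Set.mem_insert_iff, Set.mem_singleton_iff, Set.mem_range, Fin.exists_fin_succ,
      IsEmpty.exists_iff, or_false, eq_comm (a := A)]
    rfl
  rw [h, finrank_span_eq_card (linearIndependent_Hend p lam)]
  rfl
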